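/- Let G = (V, E) be a finite DAG and let B, Z, W ∈ V with Z ≠ W. If there exist a non-trivial path from B to Z and a non-trivial path from B to W whose interiors (their nodes other than the endpoints) do not intersect L∞({Z, W}), then B ∈ L∞({Z, W}). -/

import Mathlib

open scoped Classical

/-! ## Directed graphs, paths, ancestors -/

/-- A directed graph (given by its edge relation) is acyclic if no node is
reachable from itself by a non-trivial directed walk. -/
def Acyclic {V : Type} (E : V → V → Prop) : Prop :=
  ∀ v : V, ¬ Relation.TransGen E v v

/-- `IsPath E a b p` : the list `p` is a directed path from `a` to `b` in the
graph with edge relation `E` (a path is a nonempty list of nodes in which each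
node has an edge to the next; a single-node path is trivial). -/
def IsPath {V : Type} (E : V → V → Prop) (a b : V) (p : List V) : Prop :=
  p.Chain' E ∧ p.head? = some a ∧ p.getLast? = some b

/-- Descendants of `v` (every node is a descendant of itself). -/
def De {V : Type} (E : V → V → Prop) (v : V) : Set V :=
  {u | Relation.ReflTransGen E v u}

/-- Ancestors of `v` (every node is an ancestor of itself). -/
def An {V : Type} (E : V → V → Prop) (v : V) : Set V :=
  {u | Relation.ReflTransGen E u v}

/-- Parents of `v`. -/
def Pa {V : Type} (E : V → V → Prop) (v : V) : Set V :=
  {p | E p v}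

/-! ## Strict common ancestors, LSCAs, and the LSCA closure -/

/-- `v` is a strict common ancestor of `x` and `y` : there is a path from `v`
to `x` not containing `y`, and a path from `v` to `y` not containing `x`. -/
def SCA {V : Type} (E : V → V → Prop) (x y : V) : Set V :=
  {v | (∃ p, IsPath E v x p ∧ y ∉ p) ∧ (∃ p, IsPath E v y p ∧ x ∉ p)}

/-- `v` is a lowest strict common ancestor of `x` and `y` : it is a strict
common ancestor, and no strict common ancestor of `x,y` other than `v` is a
descendant of `v`. -/
def LSCApair {V : Type} (E : V → V → Prop) (x y : V) : Set V :=
  {v | v ∈ SCA E x y ∧ ∀ w ∈ SCA E x y, w ≠ v → w ∉ De E v}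

/-- The lowest strict common ancestors of a set `U` : nodes outside `U` that
are a lowest strict common ancestor of some pair of nodes of `U`. -/
def LSCAset {V : Type} (E : V → V → Prop) (U : Set V) : Set V :=
  {v | v ∉ U ∧ ∃ u ∈ U, ∃ u' ∈ U, v ∈ LSCApair E u u'}

/-- The `i`-th order LSCA set of `U`. -/
def lscaIter {V : Type} (E : V → V → Prop) (U : Set V) : ℕ → Set V
  | 0 => U
  | k + 1 => LSCAset E (lscaIter E U k) ∪ lscaIter E U k

/-- The LSCA closure `L∞(U)` of `U`.  (The sets `lscaIter E U i` are increasing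
in `i`, so on a finite node type this union equals `lscaIter E U k` for the
least `k` with `lscaIter E U k = lscaIter E U (k+1)`.) -/
def lscaClosure {V : Type} (E : V → V → Prop) (U : Set V) : Set V :=
  ⋃ k : ℕ, lscaIter E U k

/-! ## Λ-structures -/

/-- `(v, pa, pb)` is a Λ-structure over `(a, b)` : `pa` is a path from `v` to
`a`, `pb` is a path from `v` to `b`, and the two paths intersect only at `v`
(trivial paths are allowed). -/
def IsLambdaStruct {V : Type} (E : V → V → Prop) (v a b : V) (pa pb : List V) : Prop :=
  IsPath E v a pa ∧ IsPath E v b pb ∧ ∀ w ∈ pa, w ∈ pb → w = v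

/-- `Λ(U, W)` : the set of nodes forming a Λ-structure over `(U, W)`. -/
def LambdaSet {V : Type} (E : V → V → Prop) (U W : Set V) : Set V :=
  {v | ∃ u ∈ U, ∃ w ∈ W, ∃ pa pb : List V, IsLambdaStruct E v u w pa pb}

/-! ## Structural causal models -/

/-- A structural causal model over the graph with node type `V` and edge
relation `E` : each node `v` has a nonempty finite range `R v`, a nonempty
finite noise range `N v`, and a structural assignment `f v` computing the value
of `v` from the values of its parents and its noise value. -/
structure SCM (V : Type) (E : V → V → Prop) where
  R : V → Type
  rFin : ∀ v, Finite (R v)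
  rNe : ∀ v, Nonempty (R v)
  N : V → Type
  nFin : ∀ v, Finite (N v)
  nNe : ∀ v, Nonempty (N v)
  f : ∀ v : V, (∀ p : {p // E p v}, R p.1) → N v → R v

/-- Fuel-bounded approximation to the unrolled assignment. -/
noncomputable def approx {V : Type} {E : V → V → Prop} (scm : SCM V E)
    (n : ∀ v, scm.N v) : ℕ → ∀ v, scm.R v
  | 0 => fun v => (scm.rNe v).some
  | k + 1 => fun v => scm.f v (fun p => approx scm n k p.1) (n v)

/-- The unrolled assignment `f̄_v(n)` of an SCM over an acyclic graph: the value
of `v` obtained by recursively composing the structural assignments of the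
ancestors of `v`, evaluated at the unit `n`.  (On an acyclic graph every
directed path has fewer than `card V + 1` nodes, so this fuel value computes
the exact fixed point of the unrolling recursion
`f̄_v(n) = f_v((f̄_p(n))_{p ∈ Pa(v)}, n_v)`.) -/
noncomputable def unroll {V : Type} [Fintype V] {E : V → V → Prop} (scm : SCM V E)
    (n : ∀ v, scm.N v) (v : V) : scm.R v :=
  approx scm n (Fintype.card V + 1) v

/-- The atomic intervention `do(X = x)` : replace the structural assignment of
`X` by the constant function with value `x`. -/
noncomputable def SCM.intervene {V : Type} {E : V → V → Prop} (scm : SCM V E)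
    (X : V) (x : scm.R X) : SCM V E where
  R := scm.R
  rFin := scm.rFin
  rNe := scm.rNe
  N := scm.N
  nFin := scm.nFin
  nNe := scm.nNe
  f := fun v => if h : v = X then fun _ _ => h.symm ▸ x else scm.f v

/-- Fuel-bounded approximation to the blocked unrolled assignment. -/
noncomputable def blockApprox {V : Type} [Fintype V] {E : V → V → Prop} (scm : SCM V E)
    (B : V) (b : scm.R B) (n : ∀ v, scm.N v) : ℕ → ∀ v, scm.R v
  | 0 => fun v =>
      if h : v = B then h.symm ▸ b
      else if Relation.ReflTransGen E B v then (scm.rNe v).some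
      else unroll scm n v
  | k + 1 => fun v =>
      if h : v = B then h.symm ▸ b
      else if Relation.ReflTransGen E B v then
        scm.f v (fun p => blockApprox scm B b n k p.1) (n v)
      else unroll scm n v

/-- The blocked unrolled assignment `f̄_v[B](b, n)` : equal to `b` at `v = B`,
to the plain unrolled assignment `f̄_v(n)` if `v` is not a descendant of `B`,
and otherwise obtained by the unrolling recursion
`f̄_v[B](b,n) = f_v((f̄_p[B](b,n))_{p ∈ Pa(v)}, n_v)`. -/
noncomputable def blockUnroll {V : Type} [Fintype V] {E : V → V → Prop} (scm : SCM V E)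
    (B : V) (b : scm.R B) (n : ∀ v, scm.N v) (v : V) : scm.R v :=
  blockApprox scm B b n (Fintype.card V + 1) v

/-- The edge relation of the graph obtained after a conditional intervention on
`X` with conditioning set `A` : the parent set of `X` becomes `A`, and all
other edges are unchanged. -/
def condE {V : Type} (E : V → V → Prop) (X : V) (A : Set V) : V → V → Prop :=
  fun a b => (b = X ∧ a ∈ A) ∨ (b ≠ X ∧ E a b)

/-- The conditional intervention `do(X = g(A))` : replace the structural
assignment of `X` by the function that, given the values of the nodes in `A`,
outputs `g` of those values, so that `A` becomes the parent set of `X`. -/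
noncomputable def SCM.condIntervene {V : Type} {E : V → V → Prop} (scm : SCM V E)
    (X : V) (A : Set V) (g : (∀ a : A, scm.R a.1) → scm.R X) :
    SCM V (condE E X A) where
  R := scm.R
  rFin := scm.rFin
  rNe := scm.rNe
  N := scm.N
  nFin := scm.nFin
  nNe := scm.nNe
  f := fun v par nv =>
    if h : v = X then h.symm ▸ g (fun a => par ⟨a.1, Or.inl ⟨h, a.2⟩⟩)
    else scm.f v (fun p => par ⟨p.1, Or.inr ⟨h, p.2⟩⟩) nv

/-! ## Interventional superiority -/

/-- `X` is (deterministically atomic-interventionally) superior to `W` relative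
to `Y` : for every SCM over the graph in which the range of `Y` is linearly
ordered, and every unit `n`, there is `x ∈ R_X` such that for all `w ∈ R_W`,
`f̄_Y^{do(X=x)}(n) ≥ f̄_Y^{do(W=w)}(n)`. -/
def Superior {V : Type} [Fintype V] (E : V → V → Prop) (Y X W : V) : Prop :=
  ∀ (scm : SCM V E) (L : LinearOrder (scm.R Y)) (n : ∀ v, scm.N v),
    ∃ x : scm.R X, ∀ w : scm.R W,
      L.le (unroll (scm.intervene W w) n Y) (unroll (scm.intervene X x) n Y)

/-- Superiority for sets of nodes: `S ≽_Y T` iff every node of `T` is inferior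
to some node of `S`. -/
def SetSuperior {V : Type} [Fintype V] (E : V → V → Prop) (Y : V) (S T : Set V) : Prop :=
  ∀ W ∈ T, ∃ X ∈ S, Superior E Y X W

/-- A globally interventionally superior set (GISS) of the graph relative to
`Y` : a subset `U` of `V \ {Y}` with `U ≽_Y (V \ {Y}) \ U`. -/
def IsGISS {V : Type} [Fintype V] (E : V → V → Prop) (Y : V) (U : Set V) : Prop :=
  U ⊆ Set.univ \ {Y} ∧ SetSuperior E Y U ((Set.univ \ {Y}) \ U)

/-- A minimal globally interventionally superior set (mGISS): a GISS that is
minimal with respect to set inclusion. -/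
def IsMGISS {V : Type} [Fintype V] (E : V → V → Prop) (Y : V) (U : Set V) : Prop :=
  IsGISS E Y U ∧ ∀ U' : Set V, IsGISS E Y U' → U' ⊆ U → U' = U

/-- An edge whose tail lies outside `C`; a walk along such edges meets `C` at most in its
last node. -/
def AvoidEdge {V : Type} (E : V → V → Prop) (C : Set V) (a b : V) : Prop :=
  E a b ∧ a ∉ C

section Paths

variable {V : Type} {E : V → V → Prop} {C : Set V}

theorem IsPath.exists_cons_of_ne {a b : V} {p : List V} (h : IsPath E a b p) (hab : a ≠ b) :
    ∃ c q, p = a :: q ∧ E a c ∧ IsPath E c b q := by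
  obtain ⟨hc, hh, hl⟩ := h
  match p, hc, hh, hl with
  | [], _, hh, _ => simp at hh
  | [x], _, hh, hl => simp_all
  | x :: y :: l, hc, hh, hl =>
    obtain rfl : x = a := by simpa using hh
    have hc' := List.isChain_cons_cons.1 hc
    exact ⟨y, y :: l, rfl, hc'.1, hc'.2, rfl, by simpa using hl⟩

theorem IsPath.cons {a b c : V} {p : List V} (hab : E a b) (h : IsPath E b c p) :
    IsPath E a c (a :: p) := by
  obtain ⟨hc, hh, hl⟩ := h
  match p, hc, hh, hl with
  | [], _, hh, _ => simp at hh
  | x :: l, hc, hh, hl =>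
    obtain rfl : x = b := by simpa using hh
    exact ⟨List.isChain_cons_cons.2 ⟨hab, hc⟩, rfl, by simpa using hl⟩

theorem isPath_singleton (a : V) : IsPath E a a [a] :=
  ⟨List.isChain_singleton a, rfl, rfl⟩

theorem IsPath.head_mem {a b : V} {p : List V} (h : IsPath E a b p) : a ∈ p :=
  List.mem_of_mem_head? h.2.1

theorem IsPath.reflTransGen {a b : V} {p : List V} (h : IsPath E a b p) :
    Relation.ReflTransGen E a b := by
  induction p generalizing a with
  | nil => simp [IsPath] at h
  | cons x l ih =>
    by_cases hab : a = b
    · exact hab ▸ .refl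
    · obtain ⟨c, q, hq, hac, hp⟩ := h.exists_cons_of_ne hab
      obtain ⟨-, rfl⟩ := List.cons.inj hq
      exact .head hac (ih hp)

/-- A path ending in `C` has a first node in `C`. -/
theorem IsPath.exists_first_mem {a b : V} {p : List V} (h : IsPath E a b p) (hb : b ∈ C) :
    ∃ s ∈ p, s ∈ C ∧ Relation.ReflTransGen (AvoidEdge E C) a s ∧
      Relation.ReflTransGen E s b := by
  induction p generalizing a with
  | nil => simp [IsPath] at h
  | cons x l ih =>
    by_cases ha : a ∈ C
    · exact ⟨a, h.head_mem, ha, .refl, h.reflTransGen⟩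
    · obtain ⟨c, q, hq, hac, hp⟩ := h.exists_cons_of_ne (fun e => ha (e ▸ hb))
      obtain ⟨-, rfl⟩ := List.cons.inj hq
      obtain ⟨s, hs, hsC, h1, h2⟩ := ih hp
      exact ⟨s, List.mem_cons_of_mem _ hs, hsC, .head ⟨hac, ha⟩ h1, h2⟩

theorem exists_isPath_of_reflTransGen_avoidEdge {a b : V}
    (h : Relation.ReflTransGen (AvoidEdge E C) a b) :
    ∃ p, IsPath E a b p ∧ ∀ w ∈ p, w = b ∨ w ∉ C := by
  induction h using Relation.ReflTransGen.head_induction_on with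
  | refl => exact ⟨[b], isPath_singleton b, by simp⟩
  | head hac _ ih =>
    obtain ⟨p, hp, hpC⟩ := ih
    refine ⟨_, hp.cons hac.1, fun w hw => ?_⟩
    rcases List.mem_cons.1 hw with rfl | hw
    · exact .inr hac.2
    · exact hpC w hw

theorem reflTransGen_avoidEdge_or_exists {a b : V} (h : Relation.ReflTransGen E a b) :
    Relation.ReflTransGen (AvoidEdge E C) a b ∨
      ∃ c ∈ C, Relation.ReflTransGen (AvoidEdge E C) a c ∧ Relation.ReflTransGen E c b := by
  induction h using Relation.ReflTransGen.head_induction_on with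
  | refl => exact .inl .refl
  | @head a d had hdb ih =>
    by_cases ha : a ∈ C
    · exact .inr ⟨a, ha, .refl, .head had hdb⟩
    · rcases ih with h | ⟨c, hc, h1, h2⟩
      · exact .inl (.head ⟨had, ha⟩ h)
      · exact .inr ⟨c, hc, .head ⟨had, ha⟩ h1, h2⟩

theorem Relation.ReflTransGen.transGen_of_ne {a b : V} (h : Relation.ReflTransGen E a b)
    (hab : a ≠ b) : Relation.TransGen E a b :=
  (Relation.reflTransGen_iff_eq_or_transGen.1 h).resolve_left hab.symm

theorem Acyclic.antisymm (hacy : Acyclic E) {a b : V} (hab : Relation.ReflTransGen E a b)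
    (hba : Relation.ReflTransGen E b a) : a = b := by
  by_contra hne
  exact hacy a ((hab.transGen_of_ne hne).trans_left hba)

theorem Acyclic.wellFounded_transGen [Finite V] (hacy : Acyclic E) :
    WellFounded (Relation.TransGen E) :=
  haveI : Std.Irrefl (Relation.TransGen E) := ⟨hacy⟩
  Finite.wellFounded_of_trans_of_irrefl _

theorem Acyclic.wellFounded_swap_transGen [Finite V] (hacy : Acyclic E) :
    WellFounded (Function.swap (Relation.TransGen E)) :=
  haveI : Std.Irrefl (Function.swap (Relation.TransGen E)) := ⟨hacy⟩
  haveI : IsTrans V (Function.swap (Relation.TransGen E)) := ⟨fun _ _ _ h1 h2 => h2.trans h1⟩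
  Finite.wellFounded_of_trans_of_irrefl _

theorem lscaIter_mono (E : V → V → Prop) (U : Set V) : Monotone (lscaIter E U) :=
  monotone_nat_of_le_succ fun _ => Set.subset_union_right

theorem subset_lscaClosure (E : V → V → Prop) (U : Set V) : U ⊆ lscaClosure E U :=
  Set.subset_iUnion (lscaIter E U) 0

theorem mem_lscaClosure_of_mem_lscaPair {U : Set V} {x y v : V} (hx : x ∈ lscaClosure E U)
    (hy : y ∈ lscaClosure E U) (hv : v ∈ LSCApair E x y) : v ∈ lscaClosure E U := by
  obtain ⟨i, hi⟩ := Set.mem_iUnion.1 hx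
  obtain ⟨j, hj⟩ := Set.mem_iUnion.1 hy
  by_cases hvm : v ∈ lscaIter E U (max i j)
  · exact Set.mem_iUnion.2 ⟨_, hvm⟩
  · exact Set.mem_iUnion.2 ⟨max i j + 1, .inl ⟨hvm, x, lscaIter_mono E U (le_max_left i j) hi,
      y, lscaIter_mono E U (le_max_right i j) hj, hv⟩⟩

/-- If `C` is closed under lowest strict common ancestors, then a node outside `C` reaches at
most one node of `C` by walks whose other nodes avoid `C`. -/
theorem eq_of_reflTransGen_avoidEdge [Finite V] (hacy : Acyclic E)
    (hC : ∀ x ∈ C, ∀ y ∈ C, LSCApair E x y ⊆ C) {v z w : V} (hv : v ∉ C)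
    (hz : z ∈ C) (hw : w ∈ C) (hvz : Relation.ReflTransGen (AvoidEdge E C) v z)
    (hvw : Relation.ReflTransGen (AvoidEdge E C) v w) : z = w := by
  induction v using hacy.wellFounded_swap_transGen.induction generalizing z w with
  | _ v ih =>
  by_contra hzw
  let S : Set V := {c | c ∈ C ∧ Relation.ReflTransGen (AvoidEdge E C) v c}
  obtain ⟨x, ⟨hxC, hvx⟩, hxmin⟩ := hacy.wellFounded_transGen.has_min S ⟨z, hz, hvz⟩
  obtain ⟨y, hyC, hvy, hyx⟩ :
      ∃ y ∈ C, Relation.ReflTransGen (AvoidEdge E C) v y ∧ y ≠ x := by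
    by_cases h : z = x
    · exact ⟨w, hw, hvw, fun e => hzw (h.trans e.symm)⟩
    · exact ⟨z, hz, hvz, h⟩
  refine hv (hC x hxC y hyC ⟨⟨?_, ?_⟩, ?_⟩)
  · obtain ⟨p, hp, hpC⟩ := exists_isPath_of_reflTransGen_avoidEdge hvx
    exact ⟨p, hp, fun h => (hpC y h).elim hyx fun h => h hyC⟩
  · obtain ⟨p, hp, hpC⟩ := exists_isPath_of_reflTransGen_avoidEdge hvy
    exact ⟨p, hp, fun h => (hpC x h).elim hyx.symm fun h => h hxC⟩
  · rintro u ⟨⟨p, hp, -⟩, q, hq, hxq⟩ huv hvu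
    have hux : u ≠ x := fun e => hxq (e ▸ hq.head_mem)
    have no_between : ∀ c ∈ C, Relation.ReflTransGen (AvoidEdge E C) v c →
        ¬ Relation.ReflTransGen E c u := by
      intro c hc hvc hcu
      refine hxmin c ⟨hc, hvc⟩ ((hcu.trans hp.reflTransGen).transGen_of_ne ?_)
      rintro rfl
      exact hux (hacy.antisymm hp.reflTransGen hcu)
    rcases reflTransGen_avoidEdge_or_exists (C := C) hvu with h | ⟨c, hc, hvc, hcu⟩
    · by_cases huC : u ∈ C
      · exact no_between u huC h .refl
      · obtain ⟨s, -, hsC, hus, hsx⟩ := hp.exists_first_mem hxC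
        obtain ⟨t, htq, htC, hut, -⟩ := hq.exists_first_mem hyC
        have hst : s = t := ih u (hvu.transGen_of_ne huv.symm) huC hsC htC hus hut
        exact hxmin s ⟨hsC, h.trans hus⟩
          (hsx.transGen_of_ne fun e => hxq (e ▸ hst ▸ htq))
    · exact no_between c hc hvc hcu

end Paths

/-- Let `G = (V, E)` be a finite DAG and `B, Z, W ∈ V` with
`Z ≠ W`.  If there exist a non-trivial path from `B` to `Z` and a non-trivial
path from `B` to `W` whose interiors (their nodes other than the endpoints) do
not intersect `L∞({Z, W})`, then `B ∈ L∞({Z, W})`. -/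
theorem mem_closure_of_two_paths {V : Type} [Fintype V] (E : V → V → Prop)
    (hacy : Acyclic E) (B Z W : V) (hZW : Z ≠ W)
    (π₁ π₂ : List V)
    (h₁ : IsPath E B Z π₁) (hlen₁ : 2 ≤ π₁.length)
    (h₂ : IsPath E B W π₂) (hlen₂ : 2 ≤ π₂.length)
    (hint₁ : ∀ w ∈ π₁, w ≠ B → w ≠ Z → w ∉ lscaClosure E {Z, W})
    (hint₂ : ∀ w ∈ π₂, w ≠ B → w ≠ W → w ∉ lscaClosure E {Z, W}) :
    B ∈ lscaClosure E {Z, W} := by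
  by_contra hB
  have hZ : Z ∈ lscaClosure E {Z, W} := subset_lscaClosure _ _ (by simp)
  have hW : W ∈ lscaClosure E {Z, W} := subset_lscaClosure _ _ (by simp)
  obtain ⟨s, hs, hsC, hBs, -⟩ := h₁.exists_first_mem hZ
  obtain ⟨t, ht, htC, hBt, -⟩ := h₂.exists_first_mem hW
  have hsZ : s = Z := by
    by_contra h
    exact hint₁ s hs (fun e => hB (e ▸ hsC)) h hsC
  have htW : t = W := by
    by_contra h
    exact hint₂ t ht (fun e => hB (e ▸ htC)) h htC
  have hst := eq_of_reflTransGen_avoidEdge hacy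
    (fun x hx y hy _ hv => mem_lscaClosure_of_mem_lscaPair hx hy hv) hB hsC htC hBs hBt
  exact hZW (hsZ ▸ htW ▸ hst)
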